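/- The inner-problem value function of the MAC weighted sum rate problem is concave: define, for p₁ in the convex set P = { p₁ ∈ [0,∞)^N : ∑_{i=1}^k p_{1i} ≤ min(∑_{i=1}^k E_{1i}, ∑_{i=1}^k Ē_i) for all k }, the cumulative levels M_k(p₁) := min{ ∑_{i=1}^k E_{2i}, ∑_{i=1}^k (Ē_i − p_{1i}) } and G(p₁) := sup{ ∑_{i=1}^N g(p_{1i}+p_{2i}) : p₂ ∈ [0,∞)^N, ∑_{i=1}^k p_{2i} ≤ M_k(p₁) for all k = 1,…,N }. Then G is a concave function on P. -/

import Mathlib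

open Finset

/-- The rate function `g(p) = (1/2)·log₂(1+p)`. -/
noncomputable def gfun (p : ℝ) : ℝ := Real.logb 2 (1 + p) / 2

theorem gfun_concave_aux {x y a b : ℝ} (hx : 0 ≤ x) (hy : 0 ≤ y) (ha : 0 ≤ a) (hb : 0 ≤ b)
    (hab : a + b = 1) : a * gfun x + b * gfun y ≤ gfun (a * x + b * y) := by
  have h := strictConcaveOn_log_Ioi.concaveOn.2 (x := 1 + x) (y := 1 + y)
    (by simp only [Set.mem_Ioi]; linarith) (by simp only [Set.mem_Ioi]; linarith) ha hb hab
  simp only [smul_eq_mul] at h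
  have e : a * (1 + x) + b * (1 + y) = 1 + (a * x + b * y) := by linear_combination hab
  rw [e] at h
  have h2 : 0 < Real.log 2 := Real.log_pos (by norm_num)
  unfold gfun Real.logb
  have h3 := div_le_div_of_nonneg_right h h2.le
  rw [add_div, mul_div_assoc, mul_div_assoc] at h3
  linarith

theorem gfun_mono_aux {x y : ℝ} (hx : 0 ≤ x) (hxy : x ≤ y) : gfun x ≤ gfun y := by
  unfold gfun
  have := Real.logb_le_logb_of_le (b := 2) (by norm_num) (x := 1 + x) (y := 1 + y)
    (by linarith) (by linarith)
  linarith

/-- the inner-problem value function `G(p1)` of the MAC weighted sum rate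
problem is concave on the set `P` of first-user power policies. -/
theorem mac_inner_value_concave
    (N : ℕ) (hN : 1 ≤ N)
    (E1 E2 Ebar : ℕ → ℝ)
    (hE1 : ∀ i ∈ Finset.Icc 1 N, 0 ≤ E1 i)
    (hE2 : ∀ i ∈ Finset.Icc 1 N, 0 ≤ E2 i)
    (hEbar : ∀ i ∈ Finset.Icc 1 N, 0 ≤ Ebar i) :
    ConcaveOn ℝ
      {p1 : ℕ → ℝ | (∀ i ∈ Finset.Icc 1 N, 0 ≤ p1 i) ∧
        (∀ k ∈ Finset.Icc 1 N,
            ∑ i ∈ Finset.Icc 1 k, p1 i ≤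
              min (∑ i ∈ Finset.Icc 1 k, E1 i) (∑ i ∈ Finset.Icc 1 k, Ebar i))}
      (fun p1 => sSup {S : ℝ | ∃ p2 : ℕ → ℝ,
          (∀ i ∈ Finset.Icc 1 N, 0 ≤ p2 i) ∧
          (∀ k ∈ Finset.Icc 1 N,
              ∑ i ∈ Finset.Icc 1 k, p2 i ≤
                min (∑ i ∈ Finset.Icc 1 k, E2 i)
                  (∑ i ∈ Finset.Icc 1 k, (Ebar i - p1 i))) ∧
          S = ∑ i ∈ Finset.Icc 1 N, gfun (p1 i + p2 i)}) := by
  have lin : ∀ (k : ℕ) (a b : ℝ) (u v : ℕ → ℝ), ∑ i ∈ Finset.Icc 1 k, (a * u i + b * v i)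
      = a * ∑ i ∈ Finset.Icc 1 k, u i + b * ∑ i ∈ Finset.Icc 1 k, v i := by
    intro k a b u v
    rw [Finset.sum_add_distrib, Finset.mul_sum, Finset.mul_sum]
  have comb : ∀ {a b x y m : ℝ}, 0 ≤ a → 0 ≤ b → a + b = 1 → x ≤ m → y ≤ m →
      a * x + b * y ≤ m := by
    intro a b x y m ha hb hab hx hy
    have h1 := mul_le_mul_of_nonneg_left hx ha
    have h2 := mul_le_mul_of_nonneg_left hy hb
    have h3 : a * m + b * m = m := by rw [← add_mul, hab, one_mul]
    linarith
  have conv : Convex ℝ {p1 : ℕ → ℝ | (∀ i ∈ Finset.Icc 1 N, 0 ≤ p1 i) ∧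
        (∀ k ∈ Finset.Icc 1 N,
            ∑ i ∈ Finset.Icc 1 k, p1 i ≤
              min (∑ i ∈ Finset.Icc 1 k, E1 i) (∑ i ∈ Finset.Icc 1 k, Ebar i))} := by
    rintro x ⟨hx0, hx⟩ y ⟨hy0, hy⟩ a b ha hb hab
    refine ⟨fun i hi => ?_, fun k hk => ?_⟩
    · simp only [Pi.add_apply, Pi.smul_apply, smul_eq_mul]
      exact add_nonneg (mul_nonneg ha (hx0 i hi)) (mul_nonneg hb (hy0 i hi))
    · simp only [Pi.add_apply, Pi.smul_apply, smul_eq_mul]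
      rw [lin]
      exact comb ha hb hab (hx k hk) (hy k hk)
  have bdd : ∀ p1 : ℕ → ℝ, (∀ i ∈ Finset.Icc 1 N, 0 ≤ p1 i) → BddAbove {S : ℝ | ∃ p2 : ℕ → ℝ,
          (∀ i ∈ Finset.Icc 1 N, 0 ≤ p2 i) ∧
          (∀ k ∈ Finset.Icc 1 N,
              ∑ i ∈ Finset.Icc 1 k, p2 i ≤
                min (∑ i ∈ Finset.Icc 1 k, E2 i)
                  (∑ i ∈ Finset.Icc 1 k, (Ebar i - p1 i))) ∧
          S = ∑ i ∈ Finset.Icc 1 N, gfun (p1 i + p2 i)} := by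
    intro p1 h1
    refine ⟨∑ i ∈ Finset.Icc 1 N, gfun (∑ i ∈ Finset.Icc 1 N, Ebar i), ?_⟩
    rintro S ⟨p2, h2, hc, rfl⟩
    refine Finset.sum_le_sum fun i hi => gfun_mono_aux (add_nonneg (h1 i hi) (h2 i hi)) ?_
    have h3 := (le_min_iff.1 (hc N (Finset.mem_Icc.2 ⟨hN, le_rfl⟩))).2
    rw [Finset.sum_sub_distrib] at h3
    have h4 := Finset.single_le_sum h1 hi
    have h5 := Finset.single_le_sum h2 hi
    linarith
  have ne : ∀ p1 : ℕ → ℝ, (∀ k ∈ Finset.Icc 1 N,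
            ∑ i ∈ Finset.Icc 1 k, p1 i ≤
              min (∑ i ∈ Finset.Icc 1 k, E1 i) (∑ i ∈ Finset.Icc 1 k, Ebar i)) →
      {S : ℝ | ∃ p2 : ℕ → ℝ,
          (∀ i ∈ Finset.Icc 1 N, 0 ≤ p2 i) ∧
          (∀ k ∈ Finset.Icc 1 N,
              ∑ i ∈ Finset.Icc 1 k, p2 i ≤
                min (∑ i ∈ Finset.Icc 1 k, E2 i)
                  (∑ i ∈ Finset.Icc 1 k, (Ebar i - p1 i))) ∧
          S = ∑ i ∈ Finset.Icc 1 N, gfun (p1 i + p2 i)}.Nonempty := by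
    intro p1 h
    refine ⟨_, fun _ => 0, fun _ _ => le_rfl, fun k hk => ?_, rfl⟩
    rw [Finset.sum_const_zero, Finset.sum_sub_distrib]
    refine le_min (Finset.sum_nonneg fun i hi => hE2 i ?_) ?_
    · simp only [Finset.mem_Icc] at hi hk ⊢
      omega
    · have := (le_min_iff.1 (h k hk)).2
      linarith
  refine ⟨conv, ?_⟩
  intro x hx y hy a b ha hb hab
  have hz := conv hx hy ha hb hab
  simp only [smul_eq_mul]
  refine le_of_forall_pos_le_add fun ε hε => ?_
  obtain ⟨s, hs, hsl⟩ := exists_lt_of_lt_csSup (ne x hx.2) (sub_lt_self _ hε)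
  obtain ⟨t, ht, htl⟩ := exists_lt_of_lt_csSup (ne y hy.2) (sub_lt_self _ hε)
  obtain ⟨q, hq0, hq, rfl⟩ := hs
  obtain ⟨r, hr0, hr, rfl⟩ := ht
  have key := le_csSup (bdd _ hz.1) ⟨fun i => a * q i + b * r i,
    fun i hi => add_nonneg (mul_nonneg ha (hq0 i hi)) (mul_nonneg hb (hr0 i hi)), ?_, rfl⟩
  · have h1 : a * ∑ i ∈ Finset.Icc 1 N, gfun (x i + q i)
        + b * ∑ i ∈ Finset.Icc 1 N, gfun (y i + r i)
        ≤ ∑ i ∈ Finset.Icc 1 N, gfun ((a • x + b • y) i + (a * q i + b * r i)) := by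
      rw [← lin]
      refine Finset.sum_le_sum fun i hi => ?_
      refine (gfun_concave_aux (add_nonneg (hx.1 i hi) (hq0 i hi))
        (add_nonneg (hy.1 i hi) (hr0 i hi)) ha hb hab).trans (le_of_eq ?_)
      congr 1
      simp only [Pi.add_apply, Pi.smul_apply, smul_eq_mul]
      ring
    have h2 := mul_le_mul_of_nonneg_left hsl.le ha
    have h3 := mul_le_mul_of_nonneg_left htl.le hb
    rw [mul_sub] at h2 h3
    have h4 : a * ε + b * ε = ε := by rw [← add_mul, hab, one_mul]
    have h5 := h1.trans key
    linarith
  · intro k hk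
    have hqk := le_min_iff.1 (hq k hk)
    have hrk := le_min_iff.1 (hr k hk)
    rw [lin]
    refine le_min (comb ha hb hab hqk.1 hrk.1) ?_
    have e : ∑ i ∈ Finset.Icc 1 k, (Ebar i - (a • x + b • y) i)
        = ∑ i ∈ Finset.Icc 1 k, (a * (Ebar i - x i) + b * (Ebar i - y i)) := by
      refine Finset.sum_congr rfl fun i _ => ?_
      simp only [Pi.add_apply, Pi.smul_apply, smul_eq_mul]
      linear_combination (-Ebar i) * hab
    rw [e, lin]
    exact add_le_add (mul_le_mul_of_nonneg_left hqk.2 ha) (mul_le_mul_of_nonneg_left hrk.2 hb)
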